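/- Let M be the 4×4 matrix with rows (3, 1, 2, 2), (1, 0, 0, 0), (3/2, 3/2, 2, 3/2), (3, 0, 2, 3) (with rational, hence real, entries). Then the characteristic polynomial of M equals X⁴ − 8X³ + 8X² − X = X·(X − 1)·(X² − 7X + 1), and φ⁴ = (7 + 3√5)/2 is an eigenvalue of M (over ℝ), where φ = (1 + √5)/2 is the golden ratio. -/

import Mathlib

noncomputable section

open Polynomial

/-- The substitution matrix of the metatile substitution system: columns record
how many copies of each metatile `H`, `T`, `P`, `F` occur in the supertiles
`H′`, `T′`, `P′`, `F′`. -/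
def substMatrix : Matrix (Fin 4) (Fin 4) ℝ :=
  !![3, 1, 2, 2;
     1, 0, 0, 0;
     3/2, 3/2, 2, 3/2;
     3, 0, 2, 3]

/-- The golden ratio `(1 + √5)/2`. -/
def φ : ℝ := (1 + Real.sqrt 5) / 2

theorem substMatrix_charpoly :
    substMatrix.charpoly = X ^ 4 - 8 * X ^ 3 + 8 * X ^ 2 - X := by
  have h : (C (3 / 2) : ℝ[X]) * 2 = 3 := by
    rw [← map_ofNat C 2, ← C_mul, ← map_ofNat C 3]
    norm_num
  rw [Matrix.charpoly, Matrix.det_succ_row_zero]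
  simp [Fin.sum_univ_succ, Matrix.det_fin_three, Matrix.charmatrix_apply, substMatrix,
    Fin.succAbove]
  rw [show (C 2 : ℝ[X]) = 2 from map_ofNat C 2, show (C 3 : ℝ[X]) = 3 from map_ofNat C 3]
  linear_combination (2 - 2 * X ^ 2) * h

/-- The characteristic polynomial of the substitution matrix is
`X⁴ − 8X³ + 8X² − X = X·(X − 1)·(X² − 7X + 1)`, and `φ⁴ = (7 + 3√5)/2` is an
eigenvalue of the matrix. -/
theorem substMatrix_charpoly_and_eigenvalue :
    substMatrix.charpoly = X ^ 4 - 8 * X ^ 3 + 8 * X ^ 2 - X ∧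
    substMatrix.charpoly = X * (X - 1) * (X ^ 2 - 7 * X + 1) ∧
    φ ^ 4 = (7 + 3 * Real.sqrt 5) / 2 ∧
    Module.End.HasEigenvalue (Matrix.toLin' substMatrix) ((7 + 3 * Real.sqrt 5) / 2) := by
  have hs : Real.sqrt 5 ^ 2 = 5 := Real.sq_sqrt (by norm_num)
  refine ⟨substMatrix_charpoly, ?_, ?_, ?_⟩
  · rw [substMatrix_charpoly]
    ring
  · rw [φ]
    linear_combination (Real.sqrt 5 ^ 2 + 4 * Real.sqrt 5 + 11) / 16 * hs
  · rw [Module.End.hasEigenvalue_iff_isRoot_charpoly, Matrix.charpoly_toLin',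
      substMatrix_charpoly,
      show (X ^ 4 - 8 * X ^ 3 + 8 * X ^ 2 - X : ℝ[X]) = X * (X - 1) * (X ^ 2 - 7 * X + 1) by ring]
    have hq : ((7 + 3 * Real.sqrt 5) / 2) ^ 2 - 7 * ((7 + 3 * Real.sqrt 5) / 2) + 1 = 0 := by
      linear_combination 9 / 4 * hs
    simp [IsRoot.def, hq]
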